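/- Let n ∈ ℕ with n ≥ 2, let v₁, v₂, …, v_n be the path graph P_n (edges v_t v_{t+1} for 1 ≤ t < n), and let i, j ∈ {0,1}. There is NO 3-rs colouring f of P_n with f(v₁) = i and f(v_n) = j exactly in the following cases: (i) n = 2 and i = j; (ii) n = 3 and i = j = 0; (iii) n = 4 and i ≠ j; (iv) n = 6 and i = j = 0. In all other cases such a 3-rs colouring f exists. -/

import Mathlib

/-- A `k`-restricted star colouring (`k`-rs colouring) of a simple graph `G`:
a proper colouring with colours `{0,…,k-1}` such that there is no path `x,y,z`
on three distinct vertices with `f x = f z < f y`. -/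
def IsRSColoring {V : Type*} (G : SimpleGraph V) (k : ℕ) (f : V → ℕ) : Prop :=
  (∀ v, f v < k) ∧
  (∀ ⦃x y⦄, G.Adj x y → f x ≠ f y) ∧
  ∀ ⦃x y z⦄, G.Adj x y → G.Adj y z → x ≠ z → ¬(f x = f z ∧ f z < f y)

def PC (n i j : ℕ) : Prop :=
  ∃ g : ℕ → ℕ, (∀ t, g t < 3) ∧ (∀ t, t + 1 < n → g t ≠ g (t + 1)) ∧
    (∀ t, t + 2 < n → ¬ (g t = g (t + 2) ∧ g (t + 2) < g (t + 1))) ∧ g 0 = i ∧ g (n - 1) = j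

def pre (g : ℕ → ℕ) (i p q : ℕ) : ℕ → ℕ
  | 0 => i
  | 1 => p
  | 2 => q
  | t + 3 => g t

lemma PC_step (n i j : ℕ) (hn : 2 ≤ n) (h : PC n i j) : PC (n + 3) i j := by
  obtain ⟨g, h1, h2, h3, h4, h5⟩ := h
  have hi : i < 3 := h4 ▸ h1 0
  obtain ⟨p, q, hp, hq, hpq, hpi, hqi, hqx⟩ :
      ∃ p q : ℕ, p < 3 ∧ q < 3 ∧ p ≠ q ∧ p ≠ i ∧ q ≠ i ∧ q ≠ g 1 := by
    have hx := h1 1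
    have hix := h2 0 (by omega)
    rw [h4] at hix
    have hix : i ≠ g 1 := hix
    exact ⟨g 1, 3 - i - g 1, by omega, by omega, by omega, by omega, by omega, by omega⟩
  refine ⟨pre g i p q, ?_, ?_, ?_, rfl, ?_⟩
  · rintro (_ | _ | _ | t) <;> simp only [pre] <;> first | assumption | exact h1 t
  · rintro (_ | _ | _ | t) ht
    · simp only [pre]; omega
    · simp only [pre]; omega
    · simp only [pre]; omega
    · exact h2 t (by omega)
  · rintro (_ | _ | _ | t) ht
    · simp only [pre]; omega
    · simp only [pre]; omega
    · simp only [pre]; omega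
    · exact h3 t (by omega)
  · obtain ⟨m, rfl⟩ : ∃ m, n = m + 1 := ⟨n - 1, by omega⟩
    exact h5

lemma PC_mul (n i j k : ℕ) (hn : 2 ≤ n) (h : PC n i j) : PC (n + 3 * k) i j := by
  induction k with
  | zero => exact h
  | succ k ih => exact PC_step (n + 3 * k) i j (by omega) ih

lemma PC_list (l : List ℕ) (h : (∀ t < l.length, l.getD t 0 < 3) ∧
    (∀ t < l.length, t + 1 < l.length → l.getD t 0 ≠ l.getD (t + 1) 0) ∧
    (∀ t < l.length, t + 2 < l.length → ¬ (l.getD t 0 = l.getD (t + 2) 0 ∧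
      l.getD (t + 2) 0 < l.getD (t + 1) 0))) :
    PC l.length (l.getD 0 0) (l.getD (l.length - 1) 0) := by
  obtain ⟨h1, h2, h3⟩ := h
  refine ⟨fun t => l.getD t 0, fun t => ?_, fun t ht => h2 t (by omega) ht,
    fun t ht => h3 t (by omega) ht, rfl, rfl⟩
  by_cases ht : t < l.length
  · exact h1 t ht
  · simp [List.getD, not_lt.mp ht]

lemma PC_ext (m n i j : ℕ) (hm : 2 ≤ m) (h : PC m i j) (hmn : m ≤ n) (hd : n % 3 = m % 3) :
    PC n i j := by
  obtain ⟨k, rfl⟩ : ∃ k, n = m + 3 * k := ⟨(n - m) / 3, by omega⟩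
  exact PC_mul m i j k hm h

lemma PC_iff (n : ℕ) (hn : 2 ≤ n) (i j : ℕ) (q0 : 0 < n) (q1 : n - 1 < n) :
    (∃ f : Fin n → ℕ, IsRSColoring (SimpleGraph.pathGraph n) 3 f ∧
        f ⟨0, q0⟩ = i ∧ f ⟨n - 1, q1⟩ = j) ↔ PC n i j := by
  constructor
  · rintro ⟨f, ⟨h1, h2, h3⟩, h4, h5⟩
    refine ⟨fun t => if h : t < n then f ⟨t, h⟩ else 0, ?_, ?_, ?_, ?_, ?_⟩
    · intro t
      dsimp only
      split_ifs
      · exact h1 _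
      · omega
    · intro t ht
      have ht' : t < n := by omega
      simp only [ht, ht', dif_pos]
      exact h2 (SimpleGraph.pathGraph_adj.2 (Or.inl rfl))
    · intro t ht
      have ht' : t < n := by omega
      have ht'' : t + 1 < n := by omega
      simp only [ht, ht', ht'', dif_pos]
      exact h3 (SimpleGraph.pathGraph_adj.2 (Or.inl rfl))
        (SimpleGraph.pathGraph_adj.2 (Or.inl rfl)) (by simp [Fin.ext_iff])
    · have : 0 < n := by omega
      simpa only [this, dif_pos] using h4
    · have : n - 1 < n := by omega
      simpa only [this, dif_pos] using h5
  · rintro ⟨g, h1, h2, h3, h4, h5⟩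
    refine ⟨fun t => g t, ⟨fun v => h1 v, ?_, ?_⟩, h4, h5⟩
    · rintro ⟨x, hx⟩ ⟨y, hy⟩ h
      rw [SimpleGraph.pathGraph_adj] at h
      rcases h with h | h <;> dsimp only at h ⊢ <;> subst h
      · exact h2 _ hy
      · exact (h2 _ hx).symm
    · rintro ⟨x, hx⟩ ⟨y, hy⟩ ⟨z, hz⟩ h h' hne
      rw [SimpleGraph.pathGraph_adj] at h h'
      simp only [ne_eq, Fin.mk.injEq] at hne
      dsimp only at h h' ⊢
      rcases h with h | h <;> rcases h' with h' | h'
      · subst h; subst h'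
        exact h3 _ hz
      · omega
      · omega
      · subst h'; subst h
        have := h3 z hx
        rintro ⟨e1, e2⟩
        exact this ⟨e1.symm, e1 ▸ e2⟩

/-- Characterisation of the pairs of binary endpoint colours extendable to a
3-rs colouring of the path `P_n`. -/
theorem rs_path_colouring_characterisation (n : ℕ) (hn : 2 ≤ n) (i j : ℕ)
    (hi : i = 0 ∨ i = 1) (hj : j = 0 ∨ j = 1) :
    (¬ ∃ f : Fin n → ℕ, IsRSColoring (SimpleGraph.pathGraph n) 3 f ∧
        f ⟨0, by omega⟩ = i ∧ f ⟨n - 1, by omega⟩ = j) ↔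
      ((n = 2 ∧ i = j) ∨ (n = 3 ∧ i = 0 ∧ j = 0) ∨ (n = 4 ∧ i ≠ j) ∨
        (n = 6 ∧ i = 0 ∧ j = 0)) := by
  rw [PC_iff n hn i j (by omega) (by omega)]
  constructor
  · intro h
    by_contra hc
    apply h
    have a4 : PC 4 0 0 := PC_list [0, 1, 2, 0] (by decide)
    have a5 : PC 5 0 0 := PC_list [0, 2, 1, 2, 0] (by decide)
    have a9 : PC 9 0 0 := PC_list [0, 2, 1, 2, 0, 2, 1, 2, 0] (by decide)
    have b2 : PC 2 0 1 := PC_list [0, 1] (by decide)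
    have b3 : PC 3 0 1 := PC_list [0, 2, 1] (by decide)
    have b7 : PC 7 0 1 := PC_list [0, 2, 1, 2, 0, 2, 1] (by decide)
    have c2 : PC 2 1 0 := PC_list [1, 0] (by decide)
    have c3 : PC 3 1 0 := PC_list [1, 2, 0] (by decide)
    have c7 : PC 7 1 0 := PC_list [1, 2, 0, 2, 1, 2, 0] (by decide)
    have d3 : PC 3 1 1 := PC_list [1, 0, 1] (by decide)
    have d4 : PC 4 1 1 := PC_list [1, 0, 2, 1] (by decide)
    have d5 : PC 5 1 1 := PC_list [1, 2, 0, 2, 1] (by decide)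
    have hm : n % 3 = 0 ∨ n % 3 = 1 ∨ n % 3 = 2 := by omega
    rcases hi with rfl | rfl <;> rcases hj with rfl | rfl <;> rcases hm with hm | hm | hm
    · exact PC_ext 9 n _ _ (by omega) a9 (by omega) (by omega)
    · exact PC_ext 4 n _ _ (by omega) a4 (by omega) (by omega)
    · exact PC_ext 5 n _ _ (by omega) a5 (by omega) (by omega)
    · exact PC_ext 3 n _ _ (by omega) b3 (by omega) (by omega)
    · exact PC_ext 7 n _ _ (by omega) b7 (by omega) (by omega)
    · exact PC_ext 2 n _ _ (by omega) b2 (by omega) (by omega)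
    · exact PC_ext 3 n _ _ (by omega) c3 (by omega) (by omega)
    · exact PC_ext 7 n _ _ (by omega) c7 (by omega) (by omega)
    · exact PC_ext 2 n _ _ (by omega) c2 (by omega) (by omega)
    · exact PC_ext 3 n _ _ (by omega) d3 (by omega) (by omega)
    · exact PC_ext 4 n _ _ (by omega) d4 (by omega) (by omega)
    · exact PC_ext 5 n _ _ (by omega) d5 (by omega) (by omega)
  · rintro h ⟨g, h1, h2, h3, h4, h5⟩
    have u1 := h1 1
    have u2 := h1 2
    have u3 := h1 3
    have u4 := h1 4
    have v0 := h2 0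
    have v1 := h2 1
    have v2 := h2 2
    have v3 := h2 3
    have v4 := h2 4
    have w0 := h3 0
    have w1 := h3 1
    have w2 := h3 2
    have w3 := h3 3
    clear h1 h2 h3
    rcases h with ⟨rfl, h⟩ | ⟨rfl, h, h'⟩ | ⟨rfl, h⟩ | ⟨rfl, h, h'⟩ <;>
      norm_num at v0 v1 v2 v3 v4 w0 w1 w2 w3 h5 <;> clear hn
    · omega
    · omega
    · omega
    · omega
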